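/- arXiv:math/0312363 — 2 statements merged into one kernel-verified Lean document; each statement's English description precedes it below -/
import Mathlib

section
/- For every θ with 0 < θ < π and every real x, setting y := f_θ(x), one has F_θ(x) = x·y + (1/2)·Cl(2y) − (1/2)·Cl(2y + 2θ) + (1/2)·Cl(2θ). (Equivalently, the Legendre transform of F_θ is F̂_θ(y) = −(1/2)Cl(2y) + (1/2)Cl(2y+2θ) − (1/2)Cl(2θ), where y = f_θ(x) = F_θ'(x).) -/
open MeasureTheory

/-- `f θ x = −arg(1 − e^{x+iθ})`, the circle pattern angle function. -/
noncomputable def f (θ x : ℝ) : ℝ := -(1 - Complex.exp (x + θ * Complex.I)).arg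

/-- `F θ x = ∫_{−∞}^x f θ ξ dξ`. -/
noncomputable def F (θ x : ℝ) : ℝ := ∫ ξ in Set.Iic x, f θ ξ

/-- Clausen's integral, defined by its convergent Fourier series
`Cl x = ∑_{n=1}^∞ sin (n x) / n²`. -/
noncomputable def Cl (x : ℝ) : ℝ := ∑' n : ℕ, Real.sin (((n : ℝ) + 1) * x) / ((n : ℝ) + 1) ^ 2

open Filter Topology

lemma cl_summable : Summable (fun n : ℕ => 1 / ((n : ℝ) + 1) ^ 2) := by
  have := (summable_nat_add_iff 1 (f := fun n : ℕ => 1 / (n : ℝ) ^ 2)).2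
    (Real.summable_one_div_nat_pow.2 (by norm_num))
  simpa using this

lemma cl_continuous : Continuous Cl := by
  unfold Cl
  refine continuous_tsum (u := fun n : ℕ => 1 / ((n : ℝ) + 1) ^ 2) ?_ cl_summable ?_
  · intro n; fun_prop
  · intro n x
    rw [norm_div, Real.norm_eq_abs, Real.norm_of_nonneg (by positivity : (0:ℝ) ≤ ((n : ℝ) + 1) ^ 2)]
    gcongr
    exact Real.abs_sin_le_one _

/-- Abel regularization. -/
noncomputable def ClR (r x : ℝ) : ℝ :=
  ∑' n : ℕ, r ^ (n + 1) * (Real.sin (((n : ℝ) + 1) * x) / ((n : ℝ) + 1) ^ 2)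

lemma clR_bound (n : ℕ) (r x : ℝ) (h0 : 0 ≤ r) (h1 : r ≤ 1) :
    ‖r ^ (n + 1) * (Real.sin (((n : ℝ) + 1) * x) / ((n : ℝ) + 1) ^ 2)‖ ≤ 1 / ((n : ℝ) + 1) ^ 2 := by
  rw [norm_mul, norm_div, Real.norm_eq_abs (Real.sin _),
    Real.norm_of_nonneg (by positivity : (0:ℝ) ≤ ((n : ℝ) + 1) ^ 2),
    Real.norm_of_nonneg (by positivity)]
  calc _ ≤ 1 * (1 / ((n : ℝ) + 1) ^ 2) := by
        gcongr
        · exact pow_le_one₀ h0 h1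
        · exact Real.abs_sin_le_one _
    _ = _ := one_mul _

lemma clR_tendsto (x : ℝ) : Tendsto (fun r => ClR r x) (𝓝[<] 1) (𝓝 (Cl x)) := by
  have h : ContinuousOn (fun r => ClR r x) (Set.Icc 0 1) := by
    unfold ClR
    refine continuousOn_tsum (u := fun n : ℕ => 1 / ((n : ℝ) + 1) ^ 2) ?_ cl_summable ?_
    · intro n; fun_prop
    · intro n r hr
      exact clR_bound n r x hr.1 hr.2
  have h1 := h 1 (by simp)
  have e : ClR 1 x = Cl x := by simp [ClR, Cl]
  rw [ContinuousWithinAt, e] at h1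
  refine h1.mono_left ?_
  refine le_inf inf_le_left ?_
  simp only [le_principal_iff]
  exact mem_of_superset (Ioo_mem_nhdsLT (by norm_num : (0:ℝ) < 1)) Set.Ioo_subset_Icc_self

lemma clR_deriv (r : ℝ) (h0 : 0 < r) (h1 : r < 1) (x : ℝ) :
    HasDerivAt (ClR r) (-Real.log ‖1 - (r : ℂ) * Complex.exp (x * Complex.I)‖) x := by
  have key : ∑' n : ℕ, r ^ (n + 1) * (Real.cos (((n : ℝ) + 1) * x) / ((n : ℝ) + 1))
      = -Real.log ‖1 - (r : ℂ) * Complex.exp (x * Complex.I)‖ := by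
    have hz : ‖(r : ℂ) * Complex.exp (x * Complex.I)‖ < 1 := by
      rw [norm_mul, Complex.norm_exp_ofReal_mul_I, mul_one, Complex.norm_real,
        Real.norm_of_nonneg h0.le]
      exact h1
    have h := Complex.hasSum_re (Complex.hasSum_taylorSeries_neg_log' hz)
    rw [Complex.neg_re, Complex.log_re] at h
    rw [← h.tsum_eq]
    congr 1
    ext n
    have e : ((r : ℂ) * Complex.exp (x * Complex.I)) ^ (n + 1) / ((n : ℂ) + 1)
        = ((r ^ (n + 1) / ((n : ℝ) + 1) : ℝ) : ℂ)
          * Complex.exp (((((n : ℝ) + 1) * x : ℝ) : ℂ) * Complex.I) := by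
      rw [mul_pow, ← Complex.exp_nat_mul]
      push_cast
      rw [show ((n : ℂ) + 1) * (x * Complex.I) = ((n : ℂ) + 1) * x * Complex.I by ring]
      ring
    rw [e, Complex.re_ofReal_mul, Complex.exp_ofReal_mul_I_re]
    ring
  rw [← key]
  unfold ClR
  refine hasDerivAt_tsum (u := fun n : ℕ => r ^ (n + 1)) (y₀ := (0 : ℝ))
    (g := fun (n : ℕ) (x : ℝ) => r ^ (n + 1) * (Real.sin (((n : ℝ) + 1) * x) / ((n : ℝ) + 1) ^ 2))
    (g' := fun (n : ℕ) (x : ℝ) => r ^ (n + 1) * (Real.cos (((n : ℝ) + 1) * x) / ((n : ℝ) + 1)))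
    ?_ ?_ ?_ ?_ x
  · exact (summable_nat_add_iff 1).2 (summable_geometric_of_lt_one h0.le h1)
  · intro n y
    have h := ((((hasDerivAt_id y).const_mul ((n : ℝ) + 1)).sin).div_const
      (((n : ℝ) + 1) ^ 2)).const_mul (r ^ (n + 1))
    refine HasDerivAt.congr_deriv h ?_
    have : (n : ℝ) + 1 ≠ 0 := by positivity
    simp only [id]
    field_simp
  · intro n y
    rw [norm_mul, norm_div, Real.norm_of_nonneg (by positivity : 0 ≤ r ^ (n + 1)),
      Real.norm_of_nonneg (by positivity : 0 ≤ (n : ℝ) + 1), Real.norm_eq_abs]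
    have h2 : |Real.cos (((n : ℝ) + 1) * y)| / ((n : ℝ) + 1) ≤ 1 := by
      rw [div_le_one (by positivity)]
      have := Real.abs_cos_le_one (((n : ℝ) + 1) * y)
      have : (0 : ℝ) ≤ n := by positivity
      linarith
    have : 0 ≤ r ^ (n + 1) := by positivity
    nlinarith
  · simp [summable_zero]

lemma cl_deriv (t : ℝ) (h0 : 0 < t) (h1 : t < 2 * Real.pi) :
    HasDerivAt Cl (-Real.log (2 * Real.sin (t / 2))) t := by
  have hs : 0 < Real.sin (t / 2) := Real.sin_pos_of_pos_of_lt_pi (by linarith) (by linarith)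
  have hn : ‖1 - ((1 : ℝ) : ℂ) * Complex.exp (t * Complex.I)‖ = 2 * Real.sin (t / 2) := by
    rw [norm_sub_rev, mul_comm (t : ℂ), Complex.ofReal_one, one_mul,
      Complex.norm_exp_I_mul_ofReal_sub_one, Real.norm_of_nonneg (by positivity)]
  rw [← hn]
  have hc : ContinuousAt (fun q : ℝ × ℝ =>
      -Real.log ‖1 - (q.1 : ℂ) * Complex.exp (q.2 * Complex.I)‖) (1, t) := by
    refine ContinuousAt.neg (ContinuousAt.log (by fun_prop) ?_)
    show ‖1 - ((1 : ℝ) : ℂ) * Complex.exp (t * Complex.I)‖ ≠ 0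
    rw [hn]; positivity
  refine hasDerivAt_of_tendstoUniformlyOnFilter (l := 𝓝[<] (1 : ℝ)) (f := ClR)
    (f' := fun r x => -Real.log ‖1 - (r : ℂ) * Complex.exp (x * Complex.I)‖)
    (g' := fun x => -Real.log ‖1 - ((1 : ℝ) : ℂ) * Complex.exp (x * Complex.I)‖) ?_ ?_ ?_
  · rw [tendstoUniformlyOnFilter_iff_tendsto]
    refine Tendsto.mono_right (y := 𝓝 ((-Real.log ‖1 - ((1 : ℝ) : ℂ) * Complex.exp (t * Complex.I)‖),
      (-Real.log ‖1 - ((1 : ℝ) : ℂ) * Complex.exp (t * Complex.I)‖))) ?_ (nhds_le_uniformity _)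
    have hle : (𝓝[<] (1 : ℝ)) ×ˢ 𝓝 t ≤ 𝓝 ((1 : ℝ), t) := by
      rw [nhds_prod_eq]
      exact prod_mono inf_le_left le_rfl
    refine Tendsto.prodMk_nhds ?_ (hc.tendsto.mono_left hle)
    have h2 : Tendsto (fun q : ℝ × ℝ => ((1 : ℝ), q.2)) (𝓝 ((1 : ℝ), t)) (𝓝 ((1 : ℝ), t)) :=
      Continuous.tendsto' (by fun_prop) _ _ rfl
    exact (hc.tendsto.comp h2).mono_left hle
  · have : ∀ᶠ r in 𝓝[<] (1 : ℝ), r ∈ Set.Ioo (0 : ℝ) 1 := Ioo_mem_nhdsLT (by norm_num)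
    filter_upwards [this.prod_inl (𝓝 t)] with q hq
    exact clR_deriv q.1 hq.1 hq.2 q.2
  · exact Eventually.of_forall clR_tendsto

lemma w_re (θ x : ℝ) : (1 - Complex.exp (x + θ * Complex.I)).re = 1 - Real.exp x * Real.cos θ := by
  simp [Complex.exp_re]

lemma w_im (θ x : ℝ) : (1 - Complex.exp (x + θ * Complex.I)).im = - (Real.exp x * Real.sin θ) := by
  simp [Complex.exp_im]

lemma f_facts (θ : ℝ) (hθ0 : 0 < θ) (hθπ : θ < Real.pi) (x : ℝ) :
    0 < f θ x ∧ f θ x + θ < Real.pi ∧ Real.sin (f θ x) = Real.exp x * Real.sin (f θ x + θ) ∧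
      DifferentiableAt ℝ (f θ) x := by
  have hsθ := Real.sin_pos_of_pos_of_lt_pi hθ0 hθπ
  have hre := w_re θ x
  have him := w_im θ x
  have himneg : (1 - Complex.exp (x + θ * Complex.I)).im < 0 := by
    rw [him]; have := Real.exp_pos x; have := mul_pos this hsθ; linarith
  have hdiff : DifferentiableAt ℝ (f θ) x := by
    have hd : HasDerivAt (fun x : ℝ => 1 - Complex.exp (x + θ * Complex.I))
        (-(Complex.exp (x + θ * Complex.I) * 1)) x := by
      have h := ((Complex.ofRealCLM.hasDerivAt (x := x)).add_const (θ * Complex.I)).cexp.const_sub 1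
      simpa using h
    have hl := hd.clog_real (Or.inr himneg.ne)
    have := (Complex.imCLM.hasFDerivAt.comp_hasDerivAt x hl).neg
    have h2 := this.differentiableAt
    have hfe : f θ = fun t : ℝ => -(Complex.log (1 - Complex.exp (t + θ * Complex.I))).im := by
      ext t; simp only [f, Complex.log_im]
    rw [hfe]
    exact h2
  set w := 1 - Complex.exp (x + θ * Complex.I) with hw
  have hw0 : w ≠ 0 := by
    intro h; rw [h] at himneg; simp at himneg
  have hN : 0 < ‖w‖ := norm_pos_iff.2 hw0
  have hf : f θ x = -w.arg := rfl
  have h1 : 0 < f θ x := by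
    rw [hf]; linarith [Complex.arg_neg_iff.2 himneg]
  have h2 : f θ x < Real.pi := by
    rw [hf]; linarith [Complex.neg_pi_lt_arg w]
  have hs : Real.sin (f θ x) = Real.exp x * Real.sin θ / ‖w‖ := by
    rw [hf, Real.sin_neg, Complex.sin_arg, him]; ring
  have hc : Real.cos (f θ x) = (1 - Real.exp x * Real.cos θ) / ‖w‖ := by
    rw [hf, Real.cos_neg, Complex.cos_arg hw0, hre]
  have hs2 : Real.sin (f θ x + θ) = Real.sin θ / ‖w‖ := by
    rw [Real.sin_add, hs, hc]; ring
  refine ⟨h1, ?_, ?_, hdiff⟩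
  · by_contra! hcon
    have : Real.sin (f θ x + θ - Real.pi) ≥ 0 :=
      Real.sin_nonneg_of_nonneg_of_le_pi (by linarith) (by linarith)
    rw [Real.sin_sub_pi, hs2] at this
    have : 0 < Real.sin θ / ‖w‖ := by positivity
    linarith
  · rw [hs, hs2]; ring

lemma f_tendsto (θ : ℝ) : Tendsto (f θ) atBot (𝓝 0) := by
  have h1 : Tendsto (fun x : ℝ => 1 - Complex.exp (x + θ * Complex.I)) atBot (𝓝 1) := by
    have : Tendsto (fun x : ℝ => Complex.exp (x + θ * Complex.I)) atBot (𝓝 0) := by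
      rw [Complex.tendsto_exp_nhds_zero_iff]
      simp
      exact tendsto_id
    simpa using this.const_sub 1
  have h2 := ((Complex.continuousAt_arg Complex.one_mem_slitPlane).tendsto.comp h1).neg
  simp only [Complex.arg_one, neg_zero] at h2
  exact h2

lemma xf_tendsto (θ : ℝ) (hθ0 : 0 < θ) (hθπ : θ < Real.pi) :
    Tendsto (fun x => x * f θ x) atBot (𝓝 0) := by
  have h1 : Tendsto (fun x : ℝ => Real.pi / 2 * (x * Real.exp x)) atBot (𝓝 0) := by
    have := (Real.tendsto_pow_mul_exp_neg_atTop_nhds_zero 1).comp tendsto_neg_atBot_atTop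
    have := this.const_mul (-(Real.pi / 2))
    simp only [mul_zero] at this
    refine this.congr fun x => ?_
    simp
  refine tendsto_of_tendsto_of_tendsto_of_le_of_le' h1 tendsto_const_nhds ?_ ?_
  · have hp := Real.pi_pos
    filter_upwards [(f_tendsto θ).eventually_lt_const (by positivity : 0 < Real.pi / 2),
      eventually_le_atBot (0 : ℝ)] with x hx hx0
    obtain ⟨a, b, c, -⟩ := f_facts θ hθ0 hθπ x
    have h := Real.mul_le_sin a.le hx.le
    have h3 : Real.sin (f θ x) ≤ Real.exp x := by
      rw [c]
      have := Real.sin_le_one (f θ x + θ)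
      have := Real.exp_pos x
      nlinarith
    have h4 : f θ x ≤ Real.pi / 2 * Real.exp x := by
      have : Real.pi / 2 * (2 / Real.pi * f θ x) ≤ Real.pi / 2 * Real.exp x := by
        gcongr; linarith
      have e : Real.pi / 2 * (2 / Real.pi * f θ x) = f θ x := by field_simp
      linarith
    nlinarith
  · filter_upwards [eventually_le_atBot (0 : ℝ)] with x hx0
    exact mul_nonpos_of_nonpos_of_nonneg hx0 (f_facts θ hθ0 hθπ x).1.le

noncomputable def GG (θ x : ℝ) : ℝ := x * f θ x + (1 / 2) * Cl (2 * f θ x)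
      - (1 / 2) * Cl (2 * f θ x + 2 * θ) + (1 / 2) * Cl (2 * θ)

lemma gg_deriv (θ : ℝ) (hθ0 : 0 < θ) (hθπ : θ < Real.pi) (x : ℝ) :
    HasDerivAt (GG θ) (f θ x) x := by
  obtain ⟨a, b, c, d⟩ := f_facts θ hθ0 hθπ x
  have hd := d.hasDerivAt
  have hs : 0 < Real.sin (f θ x + θ) := Real.sin_pos_of_pos_of_lt_pi (by linarith) b
  have c1 := (cl_deriv (2 * f θ x) (by linarith) (by linarith)).comp x (hd.const_mul 2)
  have c2 := (cl_deriv (2 * f θ x + 2 * θ) (by linarith) (by linarith)).comp x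
    ((hd.const_mul 2).add_const (2 * θ))
  have h := ((((hasDerivAt_id x).mul hd).add (c1.const_mul (1 / 2))).sub
    (c2.const_mul (1 / 2))).add_const ((1 / 2) * Cl (2 * θ))
  refine HasDerivAt.congr_deriv (f := GG θ) h ?_
  rw [show 2 * f θ x / 2 = f θ x by ring, show (2 * f θ x + 2 * θ) / 2 = f θ x + θ by ring, c,
    show 2 * (Real.exp x * Real.sin (f θ x + θ)) = Real.exp x * (2 * Real.sin (f θ x + θ)) by ring,
    Real.log_mul (Real.exp_pos x).ne' (by positivity), Real.log_exp]
  simp only [id]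
  ring

lemma gg_tendsto (θ : ℝ) (hθ0 : 0 < θ) (hθπ : θ < Real.pi) :
    Tendsto (GG θ) atBot (𝓝 0) := by
  have h0 : Cl 0 = 0 := by simp [Cl]
  have hf := (f_tendsto θ).const_mul 2
  have h1 := (cl_continuous.tendsto _).comp hf
  have h2 := (cl_continuous.tendsto _).comp (hf.add_const (2 * θ))
  have h := (((xf_tendsto θ hθ0 hθπ).add (h1.const_mul (1 / 2))).sub
    (h2.const_mul (1 / 2))).add_const ((1 / 2) * Cl (2 * θ))
  simp only [mul_zero, h0, zero_add, add_zero, zero_sub, neg_add_cancel] at h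
  exact h

/-- Legendre transform of `F θ`: with `y = f θ x`,
`F θ x = x y + (1/2) Cl (2y) − (1/2) Cl (2y + 2θ) + (1/2) Cl (2θ)`. -/
theorem FTheta_legendre (θ : ℝ) (hθ0 : 0 < θ) (hθπ : θ < Real.pi) (x : ℝ) :
    F θ x = x * f θ x + (1 / 2) * Cl (2 * f θ x)
      - (1 / 2) * Cl (2 * f θ x + 2 * θ) + (1 / 2) * Cl (2 * θ) := by
  change F θ x = GG θ x
  have h := integral_Ioi_of_hasDerivAt_of_nonneg' (a := -x) (l := 0) (g := fun u => -GG θ (-u))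
    (g' := fun u => f θ (-u)) ?_ ?_ ?_
  · rw [integral_comp_neg_Ioi, neg_neg] at h
    unfold F
    rw [h]; ring
  · intro u _
    have := ((gg_deriv θ hθ0 hθπ (-u)).comp u (hasDerivAt_neg u)).neg
    simp only [mul_neg, mul_one, neg_neg] at this
    exact this
  · intro u _
    exact (f_facts θ hθ0 hθπ (-u)).1.le
  · simpa [Function.comp_def] using
      ((gg_tendsto θ hθ0 hθπ).comp tendsto_neg_atTop_atBot).neg
end

section
/- For every θ with 0 < θ < π and every real x, setting θ* := π − θ and p := 2·arctan( tan(θ*/2)·tanh(x/2) ), one has F_θ(x) + F_θ(−x) = p·x + Cl(θ* + p) + Cl(θ* − p) − Cl(2θ*). (Equivalently, the Legendre transform of G_θ(x) := F_θ(x)+F_θ(−x) is Ĝ_θ(p) = −Cl(θ*+p) − Cl(θ*−p) + Cl(2θ*), where p = G_θ'(x).) -/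
open MeasureTheory

lemma f_z (x θ : ℝ) : 1 - Complex.exp (x + θ * Complex.I) =
    ⟨1 - Real.exp x * Real.cos θ, -(Real.exp x * Real.sin θ)⟩ := by
  apply Complex.ext
  · simp [Complex.exp_re]
  · simp [Complex.exp_im]

lemma f_arg_bounds (θ : ℝ) (hθ0 : 0 < θ) (hθπ : θ < Real.pi) (x : ℝ) :
    (1 - Complex.exp (x + θ * Complex.I)).arg < 0 ∧
    -Real.pi < (1 - Complex.exp (x + θ * Complex.I)).arg := by
  refine ⟨?_, Complex.neg_pi_lt_arg _⟩
  rw [Complex.arg_neg_iff, f_z]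
  have := Real.sin_pos_of_pos_of_lt_pi hθ0 hθπ
  have := Real.exp_pos x
  simp only
  have : 0 < Real.exp x * Real.sin θ := by positivity
  linarith

lemma tan_half (θ : ℝ) : Real.tan ((Real.pi - θ) / 2) = Real.cos (θ/2) / Real.sin (θ/2) := by
  rw [Real.tan_eq_sin_div_cos, show (Real.pi - θ)/2 = Real.pi/2 - θ/2 by ring,
    Real.sin_pi_div_two_sub, Real.cos_pi_div_two_sub]

lemma tanh_half (x : ℝ) : Real.tanh (x/2) = (Real.exp x - 1) / (Real.exp x + 1) := by
  rw [Real.tanh_eq, show Real.exp x = Real.exp (x/2) * Real.exp (x/2) by rw [← Real.exp_add]; ring_nf,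
    Real.exp_neg]
  have := Real.exp_pos (x/2)
  field_simp

lemma f_sub (θ : ℝ) (hθ0 : 0 < θ) (hθπ : θ < Real.pi) (x : ℝ) :
    f θ x - f θ (-x) = 2 * Real.arctan (Real.tan ((Real.pi - θ) / 2) * Real.tanh (x / 2)) := by
  obtain ⟨h1, h2⟩ := f_arg_bounds θ hθ0 hθπ x
  obtain ⟨h3, h4⟩ := f_arg_bounds θ hθ0 hθπ (-x)
  have hb : 0 < Real.sin (θ/2) := Real.sin_pos_of_pos_of_lt_pi (by linarith) (by linarith)
  have hab := Real.sin_sq_add_cos_sq (θ/2)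
  have hc : Real.cos θ = Real.cos (θ/2)^2 - Real.sin (θ/2)^2 := by
    rw [← Real.cos_two_mul']; ring_nf
  have hs : Real.sin θ = 2 * Real.sin (θ/2) * Real.cos (θ/2) := by
    rw [← Real.sin_two_mul]; ring_nf
  rw [tan_half, tanh_half]
  set a := Real.cos (θ/2)
  set b := Real.sin (θ/2)
  have hu := Real.exp_pos x
  set u := Real.exp x with hu'
  set τ := a / b * ((u - 1) / (u + 1)) with hτ
  set φ := Real.arctan τ with hφ
  have hφ1 := Real.neg_pi_div_two_lt_arctan τ
  have hφ2 := Real.arctan_lt_pi_div_two τ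
  have hcos := Real.cos_sq_arctan τ
  have hcp := Real.cos_arctan_pos τ
  have htan := Real.tan_arctan τ
  rw [← hφ] at hφ1 hφ2 hcos hcp htan
  have hτp : 0 < 1 + τ^2 := by positivity
  have hsin : Real.sin φ = τ * Real.cos φ := by
    rw [← htan, Real.tan_mul_cos hcp.ne']
  have hc2 : Real.cos (2*φ) * (1 + τ^2) = 1 - τ^2 := by
    rw [Real.cos_two_mul, hcos]; field_simp; ring
  have hs2 : Real.sin (2*φ) * (1 + τ^2) = 2 * τ := by
    rw [Real.sin_two_mul, hsin, show 2 * (τ * Real.cos φ) * Real.cos φ = 2 * τ * Real.cos φ ^2 by ring, hcos]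
    field_simp
  set k := b^2 * (1+u)^2/u with hk
  have hkp : 0 < k := by positivity
  have key : (1 - Complex.exp ((-x:ℝ) + θ * Complex.I)) * (starRingEnd ℂ) (1 - Complex.exp (x + θ * Complex.I))
      = ((k * (1 + τ^2) : ℝ) : ℂ) * (Complex.cos ((2*φ : ℝ):ℂ) + Complex.sin ((2*φ : ℝ):ℂ) * Complex.I) := by
    rw [f_z, f_z, ← Complex.ofReal_cos, ← Complex.ofReal_sin]
    have e : Real.exp (-x) = 1/u := by rw [Real.exp_neg]; simp [hu']
    apply Complex.ext
    · rw [Complex.re_ofReal_mul]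
      simp only [Complex.mul_re, Complex.conj_re, Complex.conj_im, Complex.add_re, Complex.ofReal_re, Complex.ofReal_im, Complex.I_re, Complex.I_im]
      rw [e, ← hu']
      trans k * (1 - τ^2)
      · rw [hk, hτ, hc, hs]; field_simp
        have ha : a^2 = 1 - b^2 := by linarith
        have ha4 : a^4 = (1 - b^2)^2 := by rw [← ha]; ring
        ring_nf; rw [ha4, ha]; ring
      · rw [← hc2]; ring
    · rw [Complex.im_ofReal_mul]
      simp only [Complex.mul_im, Complex.conj_re, Complex.conj_im, Complex.add_im, Complex.ofReal_re, Complex.ofReal_im, Complex.I_re, Complex.I_im]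
      rw [e, ← hu']
      trans k * (2 * τ)
      · rw [hk, hτ, hc, hs]; field_simp
        ring
      · rw [← hs2]; ring
  have hne : ∀ z : ℂ, z.arg < 0 → z ≠ 0 := by
    rintro z hz rfl; simp at hz
  have hconj : ((starRingEnd ℂ) (1 - Complex.exp (x + θ * Complex.I))).arg = - (1 - Complex.exp (x + θ * Complex.I)).arg := by
    rw [Complex.arg_conj, if_neg (by linarith [Real.pi_pos])]
  have h5 := congrArg Complex.arg key
  rw [Complex.arg_mul_cos_add_sin_mul_I (by positivity) ⟨by linarith, by linarith⟩,
    Complex.arg_mul (hne _ h3) ((map_ne_zero _).2 (hne _ h1)) (by rw [hconj]; constructor <;> linarith), hconj] at h5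
  rw [← h5, f, f]; push_cast; ring

lemma f_cont (θ : ℝ) (hθ0 : 0 < θ) (hθπ : θ < Real.pi) : Continuous (f θ) := by
  unfold f
  refine Continuous.neg (continuous_iff_continuousAt.2 fun x => ?_)
  have h := (f_arg_bounds θ hθ0 hθπ x).1
  rw [Complex.arg_neg_iff] at h
  refine ContinuousAt.comp (f := fun x : ℝ => 1 - Complex.exp (x + θ * Complex.I)) (Complex.continuousAt_arg (Or.inr h.ne)) ?_
  fun_prop

lemma f_intOn (θ : ℝ) (hθ0 : 0 < θ) (hθπ : θ < Real.pi) (x : ℝ) : IntegrableOn (f θ) (Set.Iic x) := by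
  have hc := f_cont θ hθ0 hθπ
  have h1 : IntegrableOn (f θ) (Set.Iic (-1)) := by
    refine Integrable.mono' ((integrableOn_exp_Iic (-1)).const_mul (3/2)) hc.aestronglyMeasurable ?_
    filter_upwards [ae_restrict_mem measurableSet_Iic] with y hy
    have hn : ‖-Complex.exp (y + θ * Complex.I)‖ = Real.exp y := by
      rw [norm_neg, Complex.norm_exp]; simp
    have h2 : Real.exp y ≤ 1/2 := by
      have : Real.exp y ≤ Real.exp (-1) := Real.exp_le_exp.2 hy
      have := Real.exp_neg_one_lt_half
      linarith
    have h3 := Complex.norm_log_one_add_half_le_self (hn.trans_le h2)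
    rw [hn, ← sub_eq_add_neg] at h3
    refine le_trans ?_ h3
    rw [f, norm_neg, ← Complex.log_im]
    exact Complex.abs_im_le_norm _
  have h2 : IntegrableOn (f θ) (Set.Icc (-1) x) := hc.continuousOn.integrableOn_Icc
  refine (h1.union h2).mono_set ?_
  intro y hy
  rcases le_total y (-1) with h | h
  · exact Or.inl h
  · exact Or.inr ⟨h, hy⟩

lemma F_deriv (θ : ℝ) (hθ0 : 0 < θ) (hθπ : θ < Real.pi) (x : ℝ) : HasDerivAt (F θ) (f θ x) x := by
  have hc := f_cont θ hθ0 hθπ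
  have h : F θ = fun x => F θ 0 + ∫ ξ in (0:ℝ)..x, f θ ξ := by
    funext x
    rw [← intervalIntegral.integral_Iic_sub_Iic (f_intOn θ hθ0 hθπ 0) (f_intOn θ hθ0 hθπ x)]
    simp [F]
  rw [h]
  exact (hc.integral_hasStrictDerivAt 0 x).hasDerivAt.const_add _

lemma sum_sq : Summable (fun n : ℕ => 1 / ((n:ℝ)+1)^2) := by
  have := (summable_nat_add_iff 1).2 (Real.summable_one_div_nat_pow.2 (one_lt_two))
  simpa using this

lemma Cl_bound (x : ℝ) (n : ℕ) : ‖Real.sin (((n : ℝ) + 1) * x) / ((n : ℝ) + 1) ^ 2‖ ≤ 1 / ((n:ℝ)+1)^2 := by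
  rw [norm_div, Real.norm_eq_abs, Real.norm_eq_abs, abs_of_pos (by positivity : 0 < ((n:ℝ)+1)^2)]
  gcongr
  exact Real.abs_sin_le_one _

lemma Cl_summable (x : ℝ) : Summable (fun n : ℕ => Real.sin (((n : ℝ) + 1) * x) / ((n : ℝ) + 1) ^ 2) :=
  Summable.of_norm_bounded sum_sq (Cl_bound x)

lemma Cl_dup (y : ℝ) : Cl (2 * y) = 2 * Cl y - 2 * Cl (Real.pi - y) := by
  set g : ℕ → ℝ := fun n => Real.sin (((n : ℝ) + 1) * y) / ((n : ℝ) + 1) ^ 2 -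
    Real.sin (((n : ℝ) + 1) * (Real.pi - y)) / ((n : ℝ) + 1) ^ 2 with hg
  have h1 : ∀ k, g (2 * k) = 0 := by
    intro k
    have : Real.sin ((((2 * k : ℕ) : ℝ) + 1) * (Real.pi - y)) = Real.sin ((((2 * k : ℕ) : ℝ) + 1) * y) := by
      rw [← Real.sin_pi_sub, ← Real.sin_add_nat_mul_two_pi _ k]
      congr 1; push_cast; ring
    simp only [hg, this, sub_self]
  have h2 : ∀ k, g (2 * k + 1) = (1/2) * (Real.sin (((k : ℝ) + 1) * (2 * y)) / ((k : ℝ) + 1) ^ 2) := by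
    intro k
    have : Real.sin ((((2 * k + 1 : ℕ) : ℝ) + 1) * (Real.pi - y)) = - Real.sin ((((2 * k + 1: ℕ) : ℝ) + 1) * y) := by
      rw [← Real.sin_neg, ← Real.sin_add_nat_mul_two_pi (-_) (k+1)]
      congr 1; push_cast; ring
    simp only [hg, this]
    rw [show (((2 * k + 1: ℕ) : ℝ) + 1) * y = ((k : ℝ) + 1) * (2 * y) by push_cast; ring]
    push_cast
    field_simp
    ring
  have h3 := tsum_even_add_odd (f := g) (by simp [h1]) (by simp only [h2]; exact (Cl_summable _).mul_left _)
  simp only [h1, h2, tsum_zero, zero_add, tsum_mul_left] at h3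
  rw [hg, (Cl_summable y).tsum_sub (Cl_summable _)] at h3
  unfold Cl
  linarith

lemma F_zero (θ : ℝ)  : F θ 0 = Cl θ := by
  have hint : ∀ n : ℕ, ∫ x in Set.Iic (0:ℝ), Real.exp (((n:ℝ)+1) * x) = 1/((n:ℝ)+1) := by
    intro n
    rw [integral_exp_mul_Iic (by positivity)]; simp
  have hi : ∀ n : ℕ, IntegrableOn (fun x => Real.exp (((n:ℝ)+1) * x)) (Set.Iic (0:ℝ)) := fun n =>
    integrableOn_exp_mul_Iic (by positivity) 0
  have h := MeasureTheory.hasSum_integral_of_summable_integral_norm (μ := volume.restrict (Set.Iic (0:ℝ)))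
    (F := fun (n:ℕ) (x:ℝ) => (Real.sin (((n:ℝ)+1)*θ) / ((n:ℝ)+1)) * Real.exp (((n:ℝ)+1) * x))
    (fun n => (hi n).const_mul _) ?_
  · have e : ∫ x in Set.Iic (0:ℝ), ∑' n : ℕ, (Real.sin (((n:ℝ)+1)*θ) / ((n:ℝ)+1)) * Real.exp (((n:ℝ)+1) * x) = F θ 0 := by
      unfold F
      apply integral_congr_ae
      have h0 : ∀ᵐ x : ℝ ∂(volume.restrict (Set.Iic (0:ℝ))), x ≠ 0 :=
        ae_restrict_of_ae (by simp [ae_iff])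
      filter_upwards [ae_restrict_mem measurableSet_Iic, h0] with x hx hx0
      have hx' : x < 0 := lt_of_le_of_ne hx hx0
      have hn : ‖Complex.exp (x + θ * Complex.I)‖ < 1 := by
        rw [Complex.norm_exp]; simpa using hx'
      have hs := (hasSum_nat_add_iff' 1).2 (Complex.hasSum_taylorSeries_neg_log hn)
      have hs2 := Complex.hasSum_im hs
      simp only [Finset.sum_range_one, Nat.cast_zero, div_zero, sub_zero, Complex.neg_im, Complex.log_im] at hs2
      rw [f, ← hs2.tsum_eq]
      congr 1; funext n
      rw [← Complex.exp_nat_mul, show (((n+1:ℕ):ℂ)) = (((n:ℝ)+1:ℝ):ℂ) by push_cast; rfl, Complex.div_ofReal_im,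
        Complex.exp_im]
      simp
      ring
    rw [← e, ← h.tsum_eq, Cl]
    congr 1; funext n
    rw [integral_const_mul, hint]
    field_simp
  · refine Summable.of_nonneg_of_le (fun n => by positivity) (fun n => ?_) sum_sq
    have : ∀ x, ‖Real.sin (((n:ℝ)+1)*θ) / ((n:ℝ)+1) * Real.exp (((n:ℝ)+1) * x)‖ ≤ 1 / ((n:ℝ)+1) * Real.exp (((n:ℝ)+1) * x) := by
      intro x
      rw [norm_mul, norm_div, Real.norm_eq_abs, Real.norm_eq_abs, Real.norm_eq_abs, abs_of_pos (Real.exp_pos _), abs_of_pos (by positivity : 0 < ((n:ℝ)+1))]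
      gcongr
      exact Real.abs_sin_le_one _
    refine (integral_mono ((hi n).const_mul _).norm ((hi n).const_mul _) this).trans ?_
    rw [integral_const_mul, hint]
    apply le_of_eq; field_simp

lemma sum_sq' : Summable (fun n : ℕ => 1 / ((n:ℝ)+1)^2) := by
  have := (summable_nat_add_iff 1).2 (Real.summable_one_div_nat_pow.2 (one_lt_two))
  simpa using this

/-- Abel regularized Clausen. -/
noncomputable def ClA (r x : ℝ) : ℝ := ∑' n : ℕ, r^(n+1) * (Real.sin (((n : ℝ) + 1) * x) / ((n : ℝ) + 1) ^ 2)

lemma sin_bound (x : ℝ) (n : ℕ) : |Real.sin (((n : ℝ) + 1) * x) / ((n : ℝ) + 1) ^ 2| ≤ 1 / ((n:ℝ)+1)^2 := by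
  rw [abs_div, abs_of_pos (by positivity : 0 < ((n:ℝ)+1)^2)]
  gcongr
  exact Real.abs_sin_le_one _

lemma ClA_tendsto (x : ℝ) : Filter.Tendsto (fun r => ClA r x) (nhdsWithin 1 (Set.Iio 1)) (nhds (Cl x)) := by
  have h : ContinuousOn (fun r => ClA r x) (Set.Icc 0 1) := by
    unfold ClA
    refine continuousOn_tsum (u := fun n : ℕ => 1 / ((n:ℝ)+1)^2) (fun n => by fun_prop) sum_sq' ?_
    intro n r hr
    rw [norm_mul, Real.norm_eq_abs, Real.norm_eq_abs, abs_of_nonneg (pow_nonneg hr.1 _)]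
    have h1 := pow_le_one₀ (n := n+1) hr.1 hr.2
    have h2 := sin_bound x n
    calc _ ≤ 1 * (1 / ((n:ℝ)+1)^2) := by gcongr
      _ = _ := one_mul _
  have h1 := h 1 (by simp)
  have h2 : ClA 1 x = Cl x := by simp [ClA, Cl]
  rw [← h2]
  refine Filter.Tendsto.mono_left h1 ?_
  rw [← nhdsWithin_Ioo_eq_nhdsLT (zero_lt_one)]
  exact nhdsWithin_mono _ Set.Ioo_subset_Icc_self

lemma q_eq (r y : ℝ) : ‖1 - (r:ℂ) * Complex.exp (y * Complex.I)‖^2 = (1-r)^2 + 2 * r * (1 - Real.cos y) := by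
  rw [← Complex.normSq_eq_norm_sq, Complex.exp_mul_I, ← Complex.ofReal_cos, ← Complex.ofReal_sin, Complex.normSq_apply]
  simp only [Complex.sub_re, Complex.sub_im, Complex.one_re, Complex.one_im, Complex.re_ofReal_mul, Complex.im_ofReal_mul, Complex.add_re, Complex.add_im, Complex.mul_re, Complex.mul_im, Complex.ofReal_re, Complex.ofReal_im, Complex.I_re, Complex.I_im]
  linear_combination r^2 * Real.sin_sq_add_cos_sq y

lemma ClA_deriv (r : ℝ) (h0 : 0 < r) (h1 : r < 1) (y : ℝ) :
    HasDerivAt (ClA r) (-(1/2) * Real.log ((1-r)^2 + 2 * r * (1 - Real.cos y))) y := by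
  have h := hasDerivAt_tsum (u := fun n : ℕ => r^(n+1))
    (g := fun (n:ℕ) x => r^(n+1) * (Real.sin (((n : ℝ) + 1) * x) / ((n : ℝ) + 1) ^ 2))
    (g' := fun (n:ℕ) x => r^(n+1) * (Real.cos (((n : ℝ) + 1) * x) / ((n : ℝ) + 1))) (y₀ := 0)
    ((summable_nat_add_iff 1).2 (summable_geometric_of_lt_one h0.le h1)) ?_ ?_ (by simp) y
  · refine HasDerivAt.congr_deriv (f := ClA r) h ?_
    symm
    have hn : ‖(r:ℂ) * Complex.exp (y * Complex.I)‖ < 1 := by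
      rw [norm_mul, Complex.norm_exp_ofReal_mul_I]; simpa [abs_of_pos h0] using h1
    have hs := (hasSum_nat_add_iff' 1).2 (Complex.hasSum_taylorSeries_neg_log hn)
    have hs2 := Complex.hasSum_re hs
    simp only [Finset.sum_range_one, Nat.cast_zero, div_zero, sub_zero, Complex.neg_re, Complex.log_re] at hs2
    rw [← q_eq, Real.log_pow]
    trans -Real.log ‖1 - (r:ℂ) * Complex.exp (y * Complex.I)‖
    · push_cast; ring
    rw [← hs2.tsum_eq]
    congr 1; funext n
    rw [mul_pow, ← Complex.exp_nat_mul, show (((n+1:ℕ):ℂ)) = (((n:ℝ)+1:ℝ):ℂ) by push_cast; rfl, Complex.div_ofReal_re,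
      ← Complex.ofReal_pow, Complex.re_ofReal_mul, ← mul_assoc, ← Complex.ofReal_mul, Complex.exp_ofReal_mul_I_re]
    ring
  · intro n y
    have : HasDerivAt (fun x : ℝ => ((n:ℝ)+1) * x) ((n:ℝ)+1) y := by
      simpa using (hasDerivAt_id y).const_mul ((n:ℝ)+1)
    have := ((this.sin).div_const (((n:ℝ)+1)^2)).const_mul (r^(n+1))
    refine HasDerivAt.congr_deriv this ?_
    field_simp
  · intro n y
    rw [norm_mul, Real.norm_eq_abs, Real.norm_eq_abs, abs_of_nonneg (by positivity), abs_div, abs_of_pos (by positivity : 0 < (n:ℝ)+1)]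
    have : |Real.cos (((n:ℝ)+1)*y)| / ((n:ℝ)+1) ≤ 1 := by
      rw [div_le_one (by positivity)]
      have := Real.abs_cos_le_one (((n:ℝ)+1)*y)
      have : (0:ℝ) ≤ n := by positivity
      linarith
    calc _ ≤ r^(n+1) * 1 := by gcongr
      _ = _ := mul_one _

lemma one_sub_cos_pos (y : ℝ) (hy : y ∈ Set.Ioo 0 (2 * Real.pi)) : 0 < 1 - Real.cos y := by
  have := Real.sin_pos_of_pos_of_lt_pi (x := y/2) (by linarith [hy.1]) (by linarith [hy.2])
  have h2 : Real.cos y = 1 - 2 * Real.sin (y/2)^2 := by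
    rw [← Real.cos_two_mul_eq_one_sub]; ring_nf
  rw [h2]; nlinarith

lemma Cl_int (a b : ℝ) (ha : a ∈ Set.Ioo 0 (2 * Real.pi)) (hb : b ∈ Set.Ioo 0 (2 * Real.pi)) :
    Cl b - Cl a = ∫ y in a..b, -(1/2) * Real.log (2 * (1 - Real.cos y)) := by
  have hsub : Set.uIcc a b ⊆ Set.Ioo 0 (2 * Real.pi) := Set.OrdConnected.uIcc_subset Set.ordConnected_Ioo ha hb
  have hpos : ∀ y ∈ Set.uIcc a b, 0 < 1 - Real.cos y := fun y hy => one_sub_cos_pos y (hsub hy)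
  have hqpos : ∀ r : ℝ, 0 < r → ∀ y ∈ Set.uIcc a b, 0 < (1-r)^2 + 2 * r * (1 - Real.cos y) := by
    intro r hr y hy
    have := hpos y hy
    positivity
  have hqc : ∀ r : ℝ, 0 < r → ContinuousOn (fun y => -(1/2) * Real.log ((1-r)^2 + 2 * r * (1 - Real.cos y))) (Set.uIcc a b) := by
    intro r hr
    refine continuousOn_const.mul (ContinuousOn.log (by fun_prop) fun y hy => (hqpos r hr y hy).ne')
  have hev : ∀ᶠ r in nhdsWithin (1:ℝ) (Set.Iio 1), 1/2 < r ∧ r < 1 := by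
    have : Set.Ioo (1/2:ℝ) 1 ∈ nhdsWithin (1:ℝ) (Set.Iio 1) := Ioo_mem_nhdsLT (by norm_num)
    exact this
  have h1 : Filter.Tendsto (fun r => ∫ y in a..b, -(1/2) * Real.log ((1-r)^2 + 2 * r * (1 - Real.cos y)))
      (nhdsWithin 1 (Set.Iio 1)) (nhds (∫ y in a..b, -(1/2) * Real.log (2 * (1 - Real.cos y)))) := by
    refine intervalIntegral.tendsto_integral_filter_of_dominated_convergence
      (fun y => |Real.log (1 - Real.cos y)| + Real.log 5) ?_ ?_ ?_ ?_
    · filter_upwards [hev] with r hr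
      exact ((hqc r (by linarith)).mono Set.uIoc_subset_uIcc).aestronglyMeasurable measurableSet_uIoc
    · filter_upwards [hev] with r hr
      refine Filter.Eventually.of_forall fun y hy => ?_
      have hp := hpos y (Set.uIoc_subset_uIcc hy)
      have hq := hqpos r (by linarith) y (Set.uIoc_subset_uIcc hy)
      have hc := Real.neg_one_le_cos y
      have l1 : Real.log (1 - Real.cos y) ≤ Real.log ((1-r)^2 + 2 * r * (1 - Real.cos y)) :=
        Real.log_le_log hp (by nlinarith)
      have l2 : Real.log ((1-r)^2 + 2 * r * (1 - Real.cos y)) ≤ Real.log 5 :=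
        Real.log_le_log hq (by nlinarith)
      have l3 : 0 ≤ Real.log 5 := Real.log_nonneg (by norm_num)
      have l4 := neg_abs_le (Real.log (1 - Real.cos y))
      have l5 := abs_nonneg (Real.log (1 - Real.cos y))
      rw [Real.norm_eq_abs, abs_le]
      constructor <;> linarith
    · refine ContinuousOn.intervalIntegrable ?_
      refine (ContinuousOn.abs (ContinuousOn.log (by fun_prop) fun y hy => (hpos y hy).ne')).add continuousOn_const
    · refine Filter.Eventually.of_forall fun y hy => ?_
      have hp := hpos y (Set.uIoc_subset_uIcc hy)
      have : ContinuousAt (fun r : ℝ => -(1/2) * Real.log ((1-r)^2 + 2 * r * (1 - Real.cos y))) 1 := by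
        refine continuousAt_const.mul (ContinuousAt.log (by fun_prop) ?_)
        norm_num; linarith
      have := this.tendsto.mono_left (nhdsWithin_le_nhds (s := Set.Iio 1))
      simpa using this
  refine tendsto_nhds_unique (((ClA_tendsto b).sub (ClA_tendsto a))) (h1.congr' ?_)
  filter_upwards [hev] with r hr
  refine intervalIntegral.integral_eq_sub_of_hasDerivAt (fun y _ => ClA_deriv r (by linarith) hr.2 y) ?_
  exact (hqc r (by linarith)).intervalIntegrable

lemma Cl_deriv (y : ℝ) (hy : y ∈ Set.Ioo 0 (2 * Real.pi)) :
    HasDerivAt Cl (-(1/2) * Real.log (2 * (1 - Real.cos y))) y := by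
  have hc : ContinuousOn (fun y => -(1/2) * Real.log (2 * (1 - Real.cos y))) (Set.Ioo 0 (2 * Real.pi)) := by
    refine continuousOn_const.mul (ContinuousOn.log (by fun_prop) fun y hy => ?_)
    have := one_sub_cos_pos y hy
    positivity
  have h := intervalIntegral.integral_hasDerivAt_right (a := y) (b := y)
    (f := (fun y => -(1/2) * Real.log (2 * (1 - Real.cos y)))) (by simp)
    (hc.stronglyMeasurableAtFilter isOpen_Ioo y hy)
    (hc.continuousAt (isOpen_Ioo.mem_nhds hy))
  refine (h.const_add (Cl y)).congr_of_eventuallyEq ?_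
  filter_upwards [isOpen_Ioo.mem_nhds hy] with z hz
  rw [← Cl_int y z hy hz]; ring

lemma sin_ratio (A B x : ℝ) (hA : 0 < Real.cos A) (hB : 0 < Real.cos B)
    (h : Real.tan B = Real.tan A * ((Real.exp x - 1) / (Real.exp x + 1))) :
    Real.sin (A + B) = Real.exp x * Real.sin (A - B) := by
  have hx := Real.exp_pos x
  rw [Real.tan_eq_sin_div_cos, Real.tan_eq_sin_div_cos] at h
  field_simp at h
  rw [Real.sin_add, Real.sin_sub]
  linarith

theorem GTheta_legendre (θ : ℝ) (hθ0 : 0 < θ) (hθπ : θ < Real.pi) (x : ℝ) :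
    F θ x + F θ (-x) =
      (2 * Real.arctan (Real.tan ((Real.pi - θ) / 2) * Real.tanh (x / 2))) * x
      + Cl ((Real.pi - θ) + 2 * Real.arctan (Real.tan ((Real.pi - θ) / 2) * Real.tanh (x / 2)))
      + Cl ((Real.pi - θ) - 2 * Real.arctan (Real.tan ((Real.pi - θ) / 2) * Real.tanh (x / 2)))
      - Cl (2 * (Real.pi - θ)) := by
  have hT : 0 < Real.tan ((Real.pi - θ) / 2) :=
    Real.tan_pos_of_pos_of_lt_pi_div_two (by linarith) (by linarith)
  set T := Real.tan ((Real.pi - θ) / 2) with hTdef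
  have hat : Real.arctan T = (Real.pi - θ) / 2 := Real.arctan_tan (by linarith) (by linarith)
  let P : ℝ → ℝ := fun x => 2 * Real.arctan (T * Real.tanh (x / 2))
  have hP1 : ∀ x, P x < Real.pi - θ := by
    intro x
    have h : Real.arctan (T * Real.tanh (x / 2)) < Real.arctan T :=
      Real.arctan_strictMono (by nlinarith [Real.tanh_lt_one (x/2)])
    simp only [P]; linarith
  have hP2 : ∀ x, -(Real.pi - θ) < P x := by
    intro x
    have h : Real.arctan (-T) < Real.arctan (T * Real.tanh (x / 2)) :=
      Real.arctan_strictMono (by nlinarith [Real.neg_one_lt_tanh (x/2)])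
    rw [Real.arctan_neg] at h
    simp only [P]; linarith
  have hPd : ∀ x, DifferentiableAt ℝ P x := by
    intro x
    have : (fun x => Real.tanh (x / 2)) = fun x => (Real.exp x - 1) / (Real.exp x + 1) := by
      funext x; exact tanh_half x
    have h2 : DifferentiableAt ℝ (fun x => Real.tanh (x / 2)) x := by
      rw [this]
      refine DifferentiableAt.div (by fun_prop) (by fun_prop) ?_
      have := Real.exp_pos x
      positivity
    exact ((h2.const_mul T).arctan).const_mul 2
  let D : ℝ → ℝ := fun x => F θ x + F θ (-x) - (P x * x + Cl ((Real.pi - θ) + P x) + Cl ((Real.pi - θ) - P x))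
  have hD : ∀ x, HasDerivAt D 0 x := by
    intro x
    have p1 := hP1 x
    have p2 := hP2 x
    have hp := (hPd x).hasDerivAt
    have f1 := F_deriv θ hθ0 hθπ x
    have f2 := (F_deriv θ hθ0 hθπ (-x)).comp x (hasDerivAt_neg x)
    have m1 : (Real.pi - θ) + P x ∈ Set.Ioo 0 (2 * Real.pi) := ⟨by linarith, by linarith⟩
    have m2 : (Real.pi - θ) - P x ∈ Set.Ioo 0 (2 * Real.pi) := ⟨by linarith, by linarith⟩
    have c1 := (Cl_deriv _ m1).comp x (hp.const_add (Real.pi - θ))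
    have c2 := (Cl_deriv _ m2).comp x (hp.const_sub (Real.pi - θ))
    have hh := (f1.add f2).sub (((hp.mul (hasDerivAt_id x)).add c1).add c2)
    have q1 := one_sub_cos_pos _ m1
    have q2 := one_sub_cos_pos _ m2
    have hr := sin_ratio ((Real.pi - θ)/2) (P x / 2) x
      (Real.cos_pos_of_mem_Ioo ⟨by linarith, by linarith⟩)
      (Real.cos_pos_of_mem_Ioo ⟨by linarith, by linarith⟩)
      (by rw [← tanh_half, show P x / 2 = Real.arctan (T * Real.tanh (x / 2)) by simp only [P]; ring, Real.tan_arctan])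
    have hcs : ∀ y : ℝ, 1 - Real.cos y = 2 * Real.sin (y/2)^2 := by
      intro y
      have := Real.cos_two_mul_eq_one_sub (y/2)
      rw [show 2 * (y/2) = y by ring] at this
      linarith
    have hlog : Real.log (2 * (1 - Real.cos ((Real.pi - θ) + P x))) =
        2 * x + Real.log (2 * (1 - Real.cos ((Real.pi - θ) - P x))) := by
      have : 2 * (1 - Real.cos ((Real.pi - θ) + P x)) = Real.exp (2*x) * (2 * (1 - Real.cos ((Real.pi - θ) - P x))) := by
        rw [hcs, hcs, show (Real.pi - θ + P x)/2 = (Real.pi - θ)/2 + P x/2 by ring, hr,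
          show (Real.pi - θ - P x)/2 = (Real.pi - θ)/2 - P x/2 by ring,
          show Real.exp (2*x) = Real.exp x * Real.exp x by rw [← Real.exp_add]; ring_nf]
        ring
      rw [this, Real.log_mul (Real.exp_pos _).ne' (by positivity), Real.log_exp]
    have hf : f θ x - f θ (-x) = P x := f_sub θ hθ0 hθπ x
    refine HasDerivAt.congr_deriv (f := D) hh ?_
    rw [hlog]
    simp only [id]
    linear_combination hf
  have hconst : D x = D 0 := is_const_of_deriv_eq_zero (fun x => (hD x).differentiableAt) (fun x => (hD x).deriv) x 0
  have hP0 : P 0 = 0 := by simp [P]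
  have hd := Cl_dup (Real.pi - θ)
  rw [show Real.pi - (Real.pi - θ) = θ by ring] at hd
  have hF := F_zero θ
  simp only [D, hP0, neg_zero, add_zero, sub_zero, mul_zero, zero_mul] at hconst
  change F θ x + F θ (-x) = P x * x + Cl ((Real.pi - θ) + P x) + Cl ((Real.pi - θ) - P x) - Cl (2 * (Real.pi - θ))
  linarith
end
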